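/- Let p be a monic polynomial of degree n over a field K with companion matrix C, Hankel matrix M, and V = e_n e_1ᵀ ∈ K^{n×n}. Then for every integer i ≥ 2, over K(s): (sI − C)^{−1} · ( V (sI − C)^{−1} )^{i−1} = p^{−i} · b(s) b(s)ᵀ M. -/

import Mathlib

open Polynomial Matrix Kronecker

set_option synthInstance.maxHeartbeats 1000000
set_option maxHeartbeats 1000000

noncomputable section

variable {K : Type*} [Field K]

/-- The strictly proper part of a rational function. -/
def piMinus (f : RatFunc K) : RatFunc K :=
  f - algebraMap (Polynomial K) (RatFunc K) (f.num /ₘ f.denom)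

/-- A rational function is strictly proper. -/
def IsStrictlyProper (f : RatFunc K) : Prop :=
  f.num.degree < f.denom.degree

/-- Companion matrix of a polynomial, for size `n`. -/
def companion (n : ℕ) (p : Polynomial K) : Matrix (Fin n) (Fin n) K :=
  Matrix.of fun i j =>
    if (i : ℕ) + 1 = (j : ℕ) then 1
    else if (i : ℕ) = n - 1 then -(p.coeff (j : ℕ)) else 0

/-- The Hankel matrix `M(p)`. -/
def hankelM (n : ℕ) (p : Polynomial K) : Matrix (Fin n) (Fin n) K :=
  Matrix.of fun i j =>
    if (i : ℕ) + (j : ℕ) + 1 ≤ n then p.coeff ((i : ℕ) + (j : ℕ) + 1) else 0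

/-- The matrix `N_k` with ones on the superdiagonal. -/
def supN (R : Type*) [Semiring R] (k : ℕ) : Matrix (Fin k) (Fin k) R :=
  Matrix.of fun i j => if (i : ℕ) + 1 = (j : ℕ) then 1 else 0

/-- `V = eₙ e₁ᵀ`. -/
def eV (K : Type*) [Field K] (n : ℕ) : Matrix (Fin n) (Fin n) K :=
  Matrix.of fun i j => if (i : ℕ) = n - 1 ∧ (j : ℕ) = 0 then 1 else 0

/-- Jacobson block `J(p^k)`, as an `nk × nk` matrix indexed by `Fin k × Fin n`. -/
def jacobson (n : ℕ) (p : Polynomial K) (k : ℕ) :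
    Matrix (Fin k × Fin n) (Fin k × Fin n) K :=
  (1 : Matrix (Fin k) (Fin k) K) ⊗ₖ companion n p + supN K k ⊗ₖ eV K n

/-- `sI - F` as a matrix over `K(s)`. -/
def sISub {ι : Type*} [Fintype ι] [DecidableEq ι] (F : Matrix ι ι K) :
    Matrix ι ι (RatFunc K) :=
  Matrix.diagonal (fun _ => (RatFunc.X : RatFunc K)) - F.map (algebraMap K (RatFunc K))

/-- `b(s) = (1, s, …, s^{n-1})ᵀ` as a vector over `K(s)`. -/
def bVec (K : Type*) [Field K] (n : ℕ) : Fin n → RatFunc K :=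
  fun i => (RatFunc.X : RatFunc K) ^ (i : ℕ)

/-- The rank-one matrix `b(s) b(s)ᵀ`. -/
def bbT (K : Type*) [Field K] (n : ℕ) : Matrix (Fin n) (Fin n) (RatFunc K) :=
  Matrix.of fun i j => bVec K n i * bVec K n j


/-- `sI - F` is invertible over `K(s)`. -/
theorem isUnit_det_sISub {ι : Type*} [Fintype ι] [DecidableEq ι] (F : Matrix ι ι K) :
    IsUnit (sISub F).det := by
  have h : sISub F =
      (algebraMap (Polynomial K) (RatFunc K)).mapMatrix (Matrix.charmatrix F) := by
    ext i j
    by_cases hij : i = j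
    · subst hij
      simp [sISub, Matrix.charmatrix_apply_eq, RatFunc.algebraMap_eq_C]
    · simp [sISub, Matrix.charmatrix_apply_ne, hij, RatFunc.algebraMap_eq_C]
  rw [h, ← RingHom.map_det, isUnit_iff_ne_zero]
  exact (map_ne_zero_iff _ (RatFunc.algebraMap_injective K)).2 F.charpoly_monic.ne_zero

/-- The Horner tail `∑ aₘ₊ⱼ sᵐ` of `p`. -/
def hornerTail (n : ℕ) (p : Polynomial K) (j : ℕ) : RatFunc K :=
  ∑ m ∈ Finset.range (n + 1 - j), (RatFunc.X : RatFunc K) ^ m * RatFunc.C (p.coeff (m + j))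

theorem hornerTail_eq (n : ℕ) (p : Polynomial K) {j : ℕ} (hj : j ≤ n) :
    hornerTail n p j = RatFunc.X * hornerTail n p (j + 1) + RatFunc.C (p.coeff j) := by
  have h : n + 1 - j = (n + 1 - (j + 1)) + 1 := by omega
  rw [hornerTail, h, Finset.sum_range_succ', hornerTail, Finset.mul_sum]
  congr 1
  · refine Finset.sum_congr rfl fun m _ => ?_
    rw [show m + 1 + j = m + (j + 1) by ring]
    ring
  · simp

theorem hornerTail_zero {n : ℕ} {p : Polynomial K} (hdeg : p.natDegree = n) :
    hornerTail n p 0 = algebraMap (Polynomial K) (RatFunc K) p := by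
  conv_rhs => rw [p.as_sum_range_C_mul_X_pow, hdeg]
  rw [hornerTail, Nat.sub_zero, map_sum]
  refine Finset.sum_congr rfl fun m _ => ?_
  rw [map_mul, map_pow, RatFunc.algebraMap_C, RatFunc.algebraMap_X, add_zero, mul_comm]

theorem hornerTail_self {n : ℕ} {p : Polynomial K} (hp : p.Monic) (hdeg : p.natDegree = n) :
    hornerTail n p n = 1 := by
  have h : p.coeff n = 1 := hdeg ▸ hp.coeff_natDegree
  simp [hornerTail, h]

theorem bVec_vecMul_hankelM (n : ℕ) (p : Polynomial K) (j : Fin n) :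
    (bVec K n ᵥ* (hankelM n p).map (algebraMap K (RatFunc K))) j =
      hornerTail n p (j + 1) := by
  simp only [Matrix.vecMul, dotProduct, bVec, hankelM, Matrix.map_apply, Matrix.of_apply,
    RatFunc.algebraMap_eq_C]
  rw [Fin.sum_univ_eq_sum_range (fun i => (RatFunc.X : RatFunc K) ^ i *
    RatFunc.C (if i + (j : ℕ) + 1 ≤ n then p.coeff (i + (j : ℕ) + 1) else 0)) n, hornerTail]
  symm
  apply Finset.sum_subset_zero_on_sdiff
  · intro m hm
    simp only [Finset.mem_range] at hm ⊢
    omega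
  · intro m hm
    simp only [Finset.mem_sdiff, Finset.mem_range] at hm
    rw [if_neg (by omega)]
    simp
  · intro m hm
    simp only [Finset.mem_range] at hm
    rw [if_pos (by omega), add_assoc]

theorem bbT_eq_vecMulVec (n : ℕ) : bbT K n = Matrix.vecMulVec (bVec K n) (bVec K n) := rfl

theorem eV_map_eq_vecMulVec (m : ℕ) : (eV K (m + 1)).map (algebraMap K (RatFunc K)) =
    Matrix.vecMulVec (Pi.single (Fin.last m) 1) (Pi.single 0 1) := by
  ext i j
  simp only [eV, Matrix.map_apply, Matrix.of_apply, Matrix.vecMulVec_apply, Pi.single_apply,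
    Fin.ext_iff, Fin.val_last, Fin.val_zero, Nat.add_sub_cancel]
  split_ifs <;> simp_all

theorem companion_eq_sub (m : ℕ) (p : Polynomial K) (i j : Fin (m + 1)) :
    companion (m + 1) p i j =
      (if (i : ℕ) + 1 = j then 1 else 0) - (if i = Fin.last m then p.coeff j else 0) := by
  have := j.isLt
  simp only [companion, Matrix.of_apply, Fin.ext_iff, Fin.val_last, Nat.add_sub_cancel]
  split_ifs <;> first | omega | simp

theorem sISub_mulVec_bVec {m : ℕ} {p : Polynomial K} (hp : p.Monic)
    (hdeg : p.natDegree = m + 1) :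
    sISub (companion (m + 1) p) *ᵥ bVec K (m + 1) =
      Pi.single (Fin.last m) (algebraMap (Polynomial K) (RatFunc K) p) := by
  have hsum : ∑ j : Fin (m + 1), RatFunc.C (p.coeff j) * (RatFunc.X : RatFunc K) ^ (j : ℕ) +
      RatFunc.X ^ (m + 1) = algebraMap (Polynomial K) (RatFunc K) p := by
    have h : p.coeff (m + 1) = 1 := hdeg ▸ hp.coeff_natDegree
    rw [Fin.sum_univ_eq_sum_range
      (fun j => RatFunc.C (p.coeff j) * (RatFunc.X : RatFunc K) ^ j) (m + 1),
      ← hornerTail_zero hdeg, hornerTail, Nat.sub_zero, Finset.sum_range_succ _ (m + 1)]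
    simp [h, mul_comm]
  ext i
  rw [sISub, Matrix.sub_mulVec, Pi.sub_apply, Matrix.mulVec_diagonal]
  simp only [Matrix.mulVec, dotProduct, Matrix.map_apply, companion_eq_sub,
    RatFunc.algebraMap_eq_C, map_sub, sub_mul, Finset.sum_sub_distrib, bVec, ← pow_succ']
  rcases Fin.eq_castSucc_or_eq_last i with ⟨k, rfl⟩ | rfl
  · rw [Finset.sum_eq_single k.succ]
    · simp [Fin.castSucc_ne_last]
    · intro j _ hj
      rw [if_neg]
      · simp
      · rintro h
        exact hj (Fin.ext (by simpa using h.symm))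
    · simp
  · rw [Finset.sum_eq_zero]
    · simp [← hsum, add_comm]
    · intro j _
      rw [if_neg (by simp only [Fin.val_last]; omega)]
      simp

theorem bVec_vecMul_hankelM_vecMul_sISub {m : ℕ} {p : Polynomial K} (hp : p.Monic)
    (hdeg : p.natDegree = m + 1) :
    (bVec K (m + 1) ᵥ* (hankelM (m + 1) p).map (algebraMap K (RatFunc K))) ᵥ*
      sISub (companion (m + 1) p) =
      Pi.single 0 (algebraMap (Polynomial K) (RatFunc K) p) := by
  have hlast := hornerTail_self hp hdeg
  rw [funext (bVec_vecMul_hankelM (m + 1) p)]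
  ext j
  have htail := hornerTail_eq (m + 1) p j.isLt.le
  rw [sISub, Matrix.vecMul_sub, Pi.sub_apply, Matrix.vecMul_diagonal]
  simp only [Matrix.vecMul, dotProduct, Matrix.map_apply, companion_eq_sub,
    RatFunc.algebraMap_eq_C, map_sub, mul_sub, Finset.sum_sub_distrib]
  have hrow : ∑ k : Fin (m + 1), hornerTail (m + 1) p ((k : ℕ) + 1) *
      RatFunc.C (if k = Fin.last m then p.coeff j else 0) = RatFunc.C (p.coeff j) := by
    rw [Finset.sum_eq_single (Fin.last m) (fun k _ hk => by simp [hk]) (by simp), if_pos rfl,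
      Fin.val_last, hlast, one_mul]
  rw [hrow]
  refine Fin.cases (fun htail => ?_) (fun k htail => ?_) j htail
  · rw [Finset.sum_eq_zero (fun k _ => by simp), Pi.single_eq_same, ← hornerTail_zero hdeg]
    rw [Fin.val_zero] at htail ⊢
    rw [htail]
    ring
  · rw [Finset.sum_eq_single k.castSucc, Pi.single_eq_of_ne (Fin.succ_ne_zero k)]
    · simp only [Fin.val_castSucc, Fin.val_succ, if_true, map_one] at htail ⊢
      rw [htail]
      ring
    · intro l _ hl
      rw [if_neg]
      · simp
      · intro h
        exact hl (Fin.ext (by simpa using h))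
    · simp

/-- for `i ≥ 2`,
`(sI - C)⁻¹ (V (sI - C)⁻¹)^{i-1} = p^{-i} b(s) b(s)ᵀ M` over `K(s)`. -/
theorem resolvent_mul_Q_pow (n : ℕ) (hn : 1 ≤ n) (p : Polynomial K)
    (hp : p.Monic) (hdeg : p.natDegree = n) (i : ℕ) (hi : 2 ≤ i) :
    (sISub (companion n p))⁻¹ *
      ((eV K n).map (algebraMap K (RatFunc K)) * (sISub (companion n p))⁻¹) ^ (i - 1) =
    (((algebraMap (Polynomial K) (RatFunc K) p) ^ i)⁻¹) •
      (bbT K n * (hankelM n p).map (algebraMap K (RatFunc K))) := by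
  obtain ⟨m, rfl⟩ : ∃ m, n = m + 1 := ⟨n - 1, by omega⟩
  obtain ⟨k, rfl⟩ : ∃ k, i = k + 2 := ⟨i - 2, by omega⟩
  have hp0 : algebraMap (Polynomial K) (RatFunc K) p ≠ 0 :=
    (map_ne_zero_iff _ (RatFunc.algebraMap_injective K)).2 hp.ne_zero
  have hA := isUnit_det_sISub (companion (m + 1) p)
  have hb := sISub_mulVec_bVec hp hdeg
  have hc := bVec_vecMul_hankelM_vecMul_sISub hp hdeg
  have hlast := (bVec_vecMul_hankelM (m + 1) p (Fin.last m)).trans (hornerTail_self hp hdeg)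
  rw [eV_map_eq_vecMulVec, bbT_eq_vecMulVec, Matrix.vecMulVec_mul, Nat.add_sub_assoc (by simp)]
  set A := sISub (companion (m + 1) p)
  set P := algebraMap (Polynomial K) (RatFunc K) p
  set c := bVec K (m + 1) ᵥ* (hankelM (m + 1) p).map (algebraMap K (RatFunc K))
  have hb' : A⁻¹ *ᵥ Pi.single (Fin.last m) 1 = P⁻¹ • bVec K (m + 1) := by
    have h : (Pi.single (Fin.last m) 1 : Fin (m + 1) → RatFunc K) =
        P⁻¹ • (A *ᵥ bVec K (m + 1)) := by
      rw [hb, ← Pi.single_smul, smul_eq_mul, inv_mul_cancel₀ hp0]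
    rw [h, Matrix.mulVec_smul, Matrix.mulVec_mulVec, Matrix.nonsing_inv_mul _ hA,
      Matrix.one_mulVec]
  have hc' : Pi.single 0 1 ᵥ* A⁻¹ = P⁻¹ • c := by
    have h : (Pi.single 0 1 : Fin (m + 1) → RatFunc K) = P⁻¹ • (c ᵥ* A) := by
      rw [hc, ← Pi.single_smul, smul_eq_mul, inv_mul_cancel₀ hp0]
    rw [h, Matrix.smul_vecMul, Matrix.vecMul_vecMul, Matrix.mul_nonsing_inv _ hA,
      Matrix.vecMul_one]
  rw [Matrix.vecMulVec_mul, hc']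
  induction k with
  | zero =>
    rw [zero_add, pow_one, Matrix.mul_vecMulVec, hb', Matrix.smul_vecMulVec,
      Matrix.vecMulVec_smul, smul_smul, pow_two, mul_inv]
  | succ k ih =>
    rw [show k + 1 + (2 - 1) = k + (2 - 1) + 1 by ring, pow_succ, ← mul_assoc,
      ih (by omega), Matrix.smul_mul, Matrix.vecMulVec_mul_vecMulVec]
    change _ • Matrix.vecMulVec _ ((c ⬝ᵥ _) • _) = _ • Matrix.vecMulVec _ c
    rw [dotProduct_single, hlast, mul_one, one_smul, Matrix.vecMulVec_smul, smul_smul,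
      ← mul_inv, ← pow_succ, add_right_comm]

end
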